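/- Let 𝒞 be a triangulated category with a proper class ξ of triangles and enough ξ-projectives, and let A be an object of 𝒞. Then A is ξ-Gorenstein projective if and only if there exist Hom(−,𝒢𝒫(ξ))-exact triangles K_{n+1} → Gₙ → Kₙ → ΣK_{n+1} in ξ with Gₙ ∈ 𝒢𝒫(ξ) for all n ∈ ℤ and K₀ = A. -/

import Mathlib

open CategoryTheory CategoryTheory.Limits CategoryTheory.Pretriangulated

namespace GorensteinTriangulated

variable {C : Type*} [Category C] [HasZeroObject C] [HasShift C ℤ] [Preadditive C]
  [∀ n : ℤ, (shiftFunctor C n).Additive] [Pretriangulated C]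

/-- A triangle `A ⟶ B ⟶ C ⟶ ΣA` is split if it is isomorphic to the triangle
`A ⟶ A ⊞ C ⟶ C ⟶ ΣA` with structure maps `(1 0)`, `(0 1)ᵀ` and `0`. -/
def IsSplitTriangle (T : Triangle C) : Prop :=
  Nonempty (T ≅ Triangle.mk (biprod.inl : T.obj₁ ⟶ T.obj₁ ⊞ T.obj₃) biprod.snd
    (0 : T.obj₃ ⟶ T.obj₁⟦(1 : ℤ)⟧))

/-- The triangle `T` becomes a short exact sequence after applying `Hom(Q, -)`. -/
def CoExact (T : Triangle C) (Q : C) : Prop :=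
  Function.Injective (fun φ : Q ⟶ T.obj₁ => φ ≫ T.mor₁) ∧
  (∀ φ : Q ⟶ T.obj₂, φ ≫ T.mor₂ = 0 → ∃ ψ : Q ⟶ T.obj₁, φ = ψ ≫ T.mor₁) ∧
  Function.Surjective (fun φ : Q ⟶ T.obj₂ => φ ≫ T.mor₂)

/-- The triangle `T` becomes a short exact sequence after applying `Hom(-, Q)`. -/
def ContraExact (T : Triangle C) (Q : C) : Prop :=
  Function.Injective (fun φ : T.obj₃ ⟶ Q => T.mor₂ ≫ φ) ∧
  (∀ φ : T.obj₂ ⟶ Q, T.mor₁ ≫ φ = 0 → ∃ ψ : T.obj₃ ⟶ Q, φ = T.mor₂ ≫ ψ) ∧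
  Function.Surjective (fun φ : T.obj₂ ⟶ Q => T.mor₁ ≫ φ)

/-- Saturation of a class of triangles with respect to base change: in a base change
diagram, if the third vertical triangle and the second horizontal triangle are in `S`,
then the original triangle is in `S`. -/
def SaturatedBase (S : Set (Triangle C)) : Prop :=
  ∀ T ∈ (distinguishedTriangles : Set (Triangle C)),
    ∀ (M G E : C) (α : M ⟶ G) (δ : M ⟶ E) (f' : T.obj₁ ⟶ G) (g' : G ⟶ E)
      (h' : E ⟶ T.obj₁⟦(1 : ℤ)⟧) (β : G ⟶ T.obj₂) (ε : E ⟶ T.obj₃)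
      (γ : T.obj₂ ⟶ M⟦(1 : ℤ)⟧) (ζ : T.obj₃ ⟶ M⟦(1 : ℤ)⟧),
      Triangle.mk α β γ ∈ (distinguishedTriangles : Set (Triangle C)) →
      Triangle.mk f' g' h' ∈ S → Triangle.mk δ ε ζ ∈ S →
      α ≫ g' = δ → f' ≫ β = T.mor₁ → g' ≫ ε = β ≫ T.mor₂ → h' = ε ≫ T.mor₃ →
      T.mor₂ ≫ ζ = γ → T ∈ S

/-- Saturation of a class of triangles with respect to cobase change: in a cobase change
diagram, if the second vertical triangle and the third horizontal triangle are in `S`,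
then the original triangle is in `S`. -/
def SaturatedCobase (S : Set (Triangle C)) : Prop :=
  ∀ T ∈ (distinguishedTriangles : Set (Triangle C)),
    ∀ (N D F : C) (ζ : N ⟶ T.obj₁) (δ : N ⟶ T.obj₂) (α : T.obj₁ ⟶ D) (β : T.obj₂ ⟶ F)
      (f' : D ⟶ F) (g' : F ⟶ T.obj₃) (h' : T.obj₃ ⟶ D⟦(1 : ℤ)⟧)
      (η : D ⟶ N⟦(1 : ℤ)⟧) (υ : F ⟶ N⟦(1 : ℤ)⟧),
      Triangle.mk ζ α η ∈ (distinguishedTriangles : Set (Triangle C)) →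
      Triangle.mk δ β υ ∈ S → Triangle.mk f' g' h' ∈ S →
      ζ ≫ T.mor₁ = δ → T.mor₁ ≫ β = α ≫ f' → T.mor₂ = β ≫ g' →
      T.mor₃ ≫ (shiftFunctor C (1 : ℤ)).map α = h' → f' ≫ υ = η → T ∈ S

/-- A proper class of triangles in the sense of Beligiannis. -/
structure IsProperClass (S : Set (Triangle C)) : Prop where
  subset_dist : S ⊆ (distinguishedTriangles : Set (Triangle C))
  split_mem : ∀ T : Triangle C, T ∈ (distinguishedTriangles : Set (Triangle C)) →
    IsSplitTriangle T → T ∈ S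
  iso_closed : ∀ T₁ T₂ : Triangle C, Nonempty (T₁ ≅ T₂) → T₁ ∈ S → T₂ ∈ S
  sum_closed : ∀ T₁ ∈ S, ∀ T₂ ∈ S, ∀ T ∈ (distinguishedTriangles : Set (Triangle C)),
    Nonempty (T.obj₁ ≅ T₁.obj₁ ⊞ T₂.obj₁) →
    (∀ e₁ : T.obj₁ ≅ T₁.obj₁ ⊞ T₂.obj₁, ∀ e₂ : T.obj₂ ≅ T₁.obj₂ ⊞ T₂.obj₂,
      ∀ e₃ : T.obj₃ ≅ T₁.obj₃ ⊞ T₂.obj₃,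
      T.mor₁ = e₁.hom ≫ biprod.map T₁.mor₁ T₂.mor₁ ≫ e₂.inv →
      T.mor₂ = e₂.hom ≫ biprod.map T₁.mor₂ T₂.mor₂ ≫ e₃.inv →
      T.mor₃ = e₃.hom ≫ biprod.desc
        (T₁.mor₃ ≫ (shiftFunctor C (1 : ℤ)).map (biprod.inl ≫ e₁.inv))
        (T₂.mor₃ ≫ (shiftFunctor C (1 : ℤ)).map (biprod.inr ≫ e₁.inv)) → T ∈ S)
  susp_closed : ∀ T ∈ S, ∀ i : ℤ, (Triangle.shiftFunctor C i).obj T ∈ S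
  saturated : SaturatedBase S
  base_change : ∀ T ∈ S, ∀ {E : C} (ε : E ⟶ T.obj₃),
    ∃ (G : C) (f' : T.obj₁ ⟶ G) (g' : G ⟶ E) (h' : E ⟶ T.obj₁⟦(1 : ℤ)⟧) (β : G ⟶ T.obj₂),
      Triangle.mk f' g' h' ∈ S ∧ f' ≫ β = T.mor₁ ∧ g' ≫ ε = β ≫ T.mor₂ ∧ h' = ε ≫ T.mor₃
  cobase_change : ∀ T ∈ S, ∀ {D : C} (α : T.obj₁ ⟶ D),
    ∃ (F : C) (f' : D ⟶ F) (g' : F ⟶ T.obj₃) (h' : T.obj₃ ⟶ D⟦(1 : ℤ)⟧) (β : T.obj₂ ⟶ F),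
      Triangle.mk f' g' h' ∈ S ∧ T.mor₁ ≫ β = α ≫ f' ∧ T.mor₂ = β ≫ g' ∧
      T.mor₃ ≫ (shiftFunctor C (1 : ℤ)).map α = h'

/-- `P` is a `ξ`-projective object. -/
def XiProjective (S : Set (Triangle C)) (P : C) : Prop :=
  ∀ T ∈ S, CoExact T P

/-- `𝒞` has enough `ξ`-projectives. -/
def HasEnoughXiProjectives (S : Set (Triangle C)) : Prop :=
  ∀ A : C, ∃ (K P : C) (f : K ⟶ P) (g : P ⟶ A) (h : A ⟶ K⟦(1 : ℤ)⟧),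
    XiProjective S P ∧ Triangle.mk f g h ∈ S

/-- The objects admitting a complete resolution by triangles in `S` with middle terms in
`X` which are `Hom(-, Y)`-exact; `GClass S X X` is the Gorenstein category `𝒢(X)` and
`GClass S (XiProjective S) (XiProjective S)` is the class of `ξ`-Gorenstein projectives. -/
def GClass (S : Set (Triangle C)) (X Y : C → Prop) (A : C) : Prop :=
  ∃ (K P : ℤ → C) (f : ∀ n : ℤ, K (n + 1) ⟶ P n) (g : ∀ n : ℤ, P n ⟶ K n)
    (h : ∀ n : ℤ, K n ⟶ (K (n + 1))⟦(1 : ℤ)⟧),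
    K 0 = A ∧ ∀ n : ℤ, X (P n) ∧ Triangle.mk (f n) (g n) (h n) ∈ S ∧
      ∀ Q : C, Y Q → ContraExact (Triangle.mk (f n) (g n) (h n)) Q

/-- `ξ`-Gorenstein projective objects. -/
def GProjective (S : Set (Triangle C)) (A : C) : Prop :=
  GClass S (XiProjective S) (XiProjective S) A

/-- A `ξ`-exact resolution `⋯ → X₁ → X₀ → A → 0` with terms satisfying `X`, which is
`Hom(-, Q)`-exact for every `Q` satisfying `Y`. -/
def HasResolution (S : Set (Triangle C)) (X Y : C → Prop) (A : C) : Prop :=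
  ∃ (K G : ℕ → C) (f : ∀ n : ℕ, K (n + 1) ⟶ G n) (g : ∀ n : ℕ, G n ⟶ K n)
    (h : ∀ n : ℕ, K n ⟶ (K (n + 1))⟦(1 : ℤ)⟧),
    K 0 = A ∧ ∀ n : ℕ, X (G n) ∧ Triangle.mk (f n) (g n) (h n) ∈ S ∧
      ∀ Q : C, Y Q → ContraExact (Triangle.mk (f n) (g n) (h n)) Q

/-- A `ξ`-exact coresolution `0 → A → X⁰ → X¹ → ⋯` with terms satisfying `X`, which is
`Hom(-, Q)`-exact for every `Q` satisfying `Y`. -/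
def HasCoresolution (S : Set (Triangle C)) (X Y : C → Prop) (A : C) : Prop :=
  ∃ (K G : ℕ → C) (f : ∀ n : ℕ, K n ⟶ G n) (g : ∀ n : ℕ, G n ⟶ K (n + 1))
    (h : ∀ n : ℕ, K (n + 1) ⟶ (K n)⟦(1 : ℤ)⟧),
    K 0 = A ∧ ∀ n : ℕ, X (G n) ∧ Triangle.mk (f n) (g n) (h n) ∈ S ∧
      ∀ Q : C, Y Q → ContraExact (Triangle.mk (f n) (g n) (h n)) Q

/-- A finite `ξ`-exact sequence `0 → Gₙ → ⋯ → G₀ → A → 0` where the `j`-th term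
satisfies the predicate `X j`. -/
def FiniteRes (S : Set (Triangle C)) (n : ℕ) (X : ℕ → C → Prop) (A : C) : Prop :=
  ∃ (K G : ℕ → C) (f : ∀ j : ℕ, K (j + 1) ⟶ G j) (g : ∀ j : ℕ, G j ⟶ K j)
    (h : ∀ j : ℕ, K j ⟶ (K (j + 1))⟦(1 : ℤ)⟧),
    K 0 = A ∧ IsZero (K (n + 1)) ∧
    ∀ j ≤ n, X j (G j) ∧ Triangle.mk (f j) (g j) (h j) ∈ S

/-- `ξ`-Gorenstein projective dimension of `A` is at most `n`. -/
def GpdLE (S : Set (Triangle C)) (A : C) (n : ℕ) : Prop :=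
  FiniteRes S n (fun _ => GProjective S) A


/-- A morphism is `ξ`-phantom if it is killed by all maps from `ξ`-projectives. -/
def Phantom (S : Set (Triangle C)) {X Y : C} (u : X ⟶ Y) : Prop :=
  ∀ P : C, XiProjective S P → ∀ φ : P ⟶ X, φ ≫ u = 0

/-- Objects all of whose phantom maps to `ξ`-projectives vanish. -/
def PhantomPerp (S : Set (Triangle C)) (X : C) : Prop :=
  ∀ Q : C, XiProjective S Q → ∀ u : X ⟶ Q, Phantom S u → u = 0

/-- There is a triangle `L ⟶ M ⟶ N ⟶ ΣL` in `S`. -/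
def Ses (S : Set (Triangle C)) (L M N : C) : Prop :=
  ∃ (f : L ⟶ M) (g : M ⟶ N) (h : N ⟶ L⟦(1 : ℤ)⟧), Triangle.mk f g h ∈ S

/-- `L` is a syzygy of `N` along a `Y`-exact triangle in `S` with middle term in `X`. -/
def Step (S : Set (Triangle C)) (X Y : C → Prop) (L N : C) : Prop :=
  ∃ (P : C) (f : L ⟶ P) (g : P ⟶ N) (h : N ⟶ L⟦(1 : ℤ)⟧),
    X P ∧ Triangle.mk f g h ∈ S ∧ ∀ Q : C, Y Q → ContraExact (Triangle.mk f g h) Q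

theorem gClass_iff_step (S : Set (Triangle C)) (X Y : C → Prop) (A : C) :
    GClass S X Y A ↔ ∃ K : ℤ → C, K 0 = A ∧ ∀ n : ℤ, Step S X Y (K (n + 1)) (K n) := by
  constructor
  · rintro ⟨K, P, f, g, h, h0, H⟩
    exact ⟨K, h0, fun n => ⟨P n, f n, g n, h n, H n⟩⟩
  · rintro ⟨K, h0, H⟩
    choose P f g h H using H
    exact ⟨K, P, f, g, h, h0, H⟩

theorem gClass_of_stable {S : Set (Triangle C)} {X Y D : C → Prop}
    (hl : ∀ B, D B → ∃ L, D L ∧ Step S X Y L B)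
    (hr : ∀ B, D B → ∃ N, D N ∧ Step S X Y B N) {A : C} (hA : D A) : GClass S X Y A := by
  rw [gClass_iff_step]
  choose! l hlD hlS using hl
  choose! r hrD hrS using hr
  have hl' : ∀ n : ℕ, D (l^[n] A) := fun n => by
    induction n with
    | zero => exact hA
    | succ n ih => rw [Function.iterate_succ_apply']; exact hlD _ ih
  have hr' : ∀ n : ℕ, D (r^[n] A) := fun n => by
    induction n with
    | zero => exact hA
    | succ n ih => rw [Function.iterate_succ_apply']; exact hrD _ ih
  let K : ℤ → C := fun n => match n with
    | Int.ofNat n => l^[n] A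
    | Int.negSucc n => r^[n + 1] A
  refine ⟨K, rfl, fun n => ?_⟩
  rcases n with n | n
  · have e : K (Int.ofNat n + 1) = l (K (Int.ofNat n)) := Function.iterate_succ_apply' l n A
    rw [e]
    exact hlS _ (hl' n)
  · have e : K (Int.negSucc n) = r (K (Int.negSucc n + 1)) ∧ D (K (Int.negSucc n + 1)) := by
      rcases n with - | n
      · exact ⟨rfl, hA⟩
      · exact ⟨Function.iterate_succ_apply' r (n + 1) A, hr' (n + 1)⟩
    rw [e.1]
    exact hrS _ e.2

theorem contraExact_of_isIso_mor₁ {T : Triangle C}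
    (hT : T ∈ (distinguishedTriangles : Set (Triangle C))) (h : IsIso T.mor₁) (Q : C) :
    ContraExact T Q := by
  have hz : IsZero T.obj₃ := T.isZero₃_of_isIso₁ hT h
  refine ⟨fun _ _ _ => hz.eq_of_src _ _, fun φ hφ => ⟨0, ?_⟩, fun φ => ⟨inv T.mor₁ ≫ φ, by simp⟩⟩
  rw [comp_zero, ← cancel_epi T.mor₁, hφ, comp_zero]

theorem contraExact_of_isIso_mor₂ {T : Triangle C}
    (hT : T ∈ (distinguishedTriangles : Set (Triangle C))) (h : IsIso T.mor₂) (Q : C) :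
    ContraExact T Q := by
  have hz : IsZero T.obj₁ := T.isZero₁_of_isIso₂ hT h
  refine ⟨fun φ ψ e => (cancel_epi T.mor₂).1 e, fun φ hφ => ⟨inv T.mor₂ ≫ φ, by simp⟩,
    fun φ => ⟨0, hz.eq_of_src _ _⟩⟩

section Distinguished

variable {L M N : C} {f : L ⟶ M} {g : M ⟶ N} {h : N ⟶ L⟦(1 : ℤ)⟧}

theorem dist_rotate_iff :
    Triangle.mk f g h ∈ (distinguishedTriangles : Set (Triangle C)) ↔
      Triangle.mk g h (-f⟦(1 : ℤ)⟧') ∈ (distinguishedTriangles : Set (Triangle C)) :=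
  rotate_distinguished_triangle _

variable (hT : Triangle.mk f g h ∈ (distinguishedTriangles : Set (Triangle C)))
include hT

theorem dist_zero₂₃ : g ≫ h = 0 := comp_distTriang_mor_zero₂₃ _ hT

theorem dist_desc₂ {X : C} (u : M ⟶ X) (hu : f ≫ u = 0) : ∃ v : N ⟶ X, u = g ≫ v :=
  Triangle.yoneda_exact₂ _ hT u hu

theorem dist_desc₃ {X : C} (u : N ⟶ X) (hu : g ≫ u = 0) :
    ∃ v : L⟦(1 : ℤ)⟧ ⟶ X, u = h ≫ v :=
  Triangle.yoneda_exact₃ _ hT u hu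

theorem dist_lift₂ {X : C} (u : X ⟶ M) (hu : u ≫ g = 0) : ∃ v : X ⟶ L, u = v ≫ f :=
  Triangle.coyoneda_exact₂ _ hT u hu

theorem dist_lift₃ {X : C} (u : X ⟶ N) (hu : u ≫ h = 0) : ∃ v : X ⟶ M, u = v ≫ g :=
  Triangle.coyoneda_exact₃ _ hT u hu

theorem dist_extend {X : C} (u : L ⟶ X) (hu : h ≫ u⟦(1 : ℤ)⟧' = 0) : ∃ v : M ⟶ X, f ≫ v = u := by
  obtain ⟨v, hv⟩ := dist_desc₂ (dist_rotate_iff.1 (dist_rotate_iff.1 hT)) (u⟦(1 : ℤ)⟧') hu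
  obtain ⟨v, rfl⟩ := (shiftFunctor C (1 : ℤ)).map_surjective v
  refine ⟨-v, (shiftFunctor C (1 : ℤ)).map_injective ?_⟩
  simp [hv]

end Distinguished

theorem phantom_mor₃ {S : Set (Triangle C)} (hS : IsProperClass S) {L M N : C} {f : L ⟶ M}
    {g : M ⟶ N} {h : N ⟶ L⟦(1 : ℤ)⟧} (hT : Triangle.mk f g h ∈ S) : Phantom S h := by
  intro P hP φ
  obtain ⟨(ψ : P ⟶ M), hψ : ψ ≫ g = φ⟩ := (hP _ hT).2.2 φ
  rw [← hψ, Category.assoc, dist_zero₂₃ (hS.subset_dist hT), comp_zero]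

theorem Phantom.comp {S : Set (Triangle C)} {X Y Z : C} {u : X ⟶ Y} (hu : Phantom S u)
    (v : Y ⟶ Z) : Phantom S (u ≫ v) := fun P hP φ => by
  rw [← Category.assoc, hu P hP φ, zero_comp]

theorem Phantom.precomp {S : Set (Triangle C)} {X Y Z : C} {u : X ⟶ Y} (hu : Phantom S u)
    (v : Z ⟶ X) : Phantom S (v ≫ u) := fun P hP φ => by
  rw [← Category.assoc, hu P hP]

theorem mem_of_phantom {S : Set (Triangle C)} (hS : IsProperClass S)
    (hE : HasEnoughXiProjectives S) {L M N : C} {f : L ⟶ M} {g : M ⟶ N} {h : N ⟶ L⟦(1 : ℤ)⟧}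
    (hT : Triangle.mk f g h ∈ (distinguishedTriangles : Set (Triangle C))) (hh : Phantom S h) :
    Triangle.mk f g h ∈ S := by
  obtain ⟨K, P, a, b, c, hP, hK⟩ := hE N
  obtain ⟨α, hα⟩ := dist_desc₃ (hS.subset_dist hK) h (hh P hP b)
  obtain ⟨α, rfl⟩ := (shiftFunctor C (1 : ℤ)).map_surjective α
  obtain ⟨F, (f' : L ⟶ F), (g' : F ⟶ N), (h' : N ⟶ L⟦(1 : ℤ)⟧), (β : P ⟶ F), hF, -, -, e⟩ :=
    hS.cobase_change _ hK α
  replace e : c ≫ α⟦(1 : ℤ)⟧' = h' := e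
  refine hS.iso_closed _ _ ⟨isoTriangleOfIso₁₃ _ _ (hS.subset_dist hF) hT (Iso.refl _) (Iso.refl _)
    ?_⟩ hF
  change h' ≫ (𝟙 L)⟦(1 : ℤ)⟧' = 𝟙 N ≫ h
  rw [CategoryTheory.Functor.map_id, Category.comp_id, Category.id_comp, ← e]
  exact hα.symm

theorem XiProjective.shift {S : Set (Triangle C)} (hS : IsProperClass S) {Q : C}
    (hQ : XiProjective S Q) : XiProjective S (Q⟦(1 : ℤ)⟧) := by
  intro T hT
  obtain ⟨h₁, -, h₃⟩ := hQ _ (hS.susp_closed T hT (-1))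
  replace h₁ : ∀ φ ψ : Q ⟶ T.obj₁⟦(-1 : ℤ)⟧, φ ≫ ((-1 : ℤ).negOnePow • T.mor₁⟦(-1 : ℤ)⟧') =
    ψ ≫ ((-1 : ℤ).negOnePow • T.mor₁⟦(-1 : ℤ)⟧') → φ = ψ := fun _ _ h => h₁ h
  replace h₃ : ∀ φ : Q ⟶ T.obj₃⟦(-1 : ℤ)⟧, ∃ ψ : Q ⟶ T.obj₂⟦(-1 : ℤ)⟧,
    ψ ≫ ((-1 : ℤ).negOnePow • T.mor₂⟦(-1 : ℤ)⟧') = φ := h₃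
  let e : Q⟦(1 : ℤ)⟧⟦(-1 : ℤ)⟧ ≅ Q := (shiftEquiv C (1 : ℤ)).unitIso.symm.app Q
  refine ⟨fun φ ψ hφψ => ?_, fun φ hφ => ?_, fun φ => ?_⟩
  · replace hφψ : φ ≫ T.mor₁ = ψ ≫ T.mor₁ := hφψ
    apply (shiftFunctor C (-1 : ℤ)).map_injective
    rw [← cancel_epi e.inv]
    apply h₁
    simp only [Linear.comp_units_smul, Category.assoc, ← Functor.map_comp, hφψ]
  · exact Triangle.coyoneda_exact₂ _ (hS.subset_dist hT) _ hφ
  · obtain ⟨ψ, hψ⟩ := h₃ (e.inv ≫ φ⟦(-1 : ℤ)⟧')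
    obtain ⟨χ, hχ⟩ := (shiftFunctor C (-1 : ℤ)).map_surjective (e.hom ≫ ψ)
    refine ⟨-χ, ?_⟩
    change (-χ) ≫ T.mor₂ = φ
    apply (shiftFunctor C (-1 : ℤ)).map_injective
    rw [← cancel_epi e.inv, ← hψ]
    simp [hχ]

theorem PhantomPerp.contraExact_mk {S : Set (Triangle C)} (hS : IsProperClass S) {L M N : C}
    {f : L ⟶ M} {g : M ⟶ N} {h : N ⟶ L⟦(1 : ℤ)⟧} (hN : PhantomPerp S N)
    (hT : Triangle.mk f g h ∈ S) {Q : C} (hQ : XiProjective S Q) :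
    ContraExact (Triangle.mk f g h) Q := by
  have hd := hS.subset_dist hT
  have hh := phantom_mor₃ hS hT
  refine ⟨fun (φ ψ : N ⟶ Q) (e : g ≫ φ = g ≫ ψ) => ?_, fun φ hφ => dist_desc₂ hd φ hφ,
    fun (φ : L ⟶ Q) => dist_extend hd φ (hN _ (hQ.shift hS) _ (hh.comp _))⟩
  obtain ⟨χ, hχ⟩ := dist_desc₃ hd (φ - ψ) (by rw [Preadditive.comp_sub, e, sub_self])
  rw [hN Q hQ _ (hh.comp χ)] at hχ
  exact sub_eq_zero.1 hχ

theorem PhantomPerp.of_contraExact {S : Set (Triangle C)} {L M N : C}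
    {f : L ⟶ M} {g : M ⟶ N} {h : N ⟶ L⟦(1 : ℤ)⟧} (hM : PhantomPerp S M)
    (hc : ∀ Q : C, XiProjective S Q → ContraExact (Triangle.mk f g h) Q) : PhantomPerp S N := by
  intro Q hQ u hu
  refine (hc Q hQ).1 (?_ : g ≫ u = g ≫ 0)
  rw [comp_zero, hM Q hQ _ (hu.precomp g)]

theorem XiProjective.phantomPerp {S : Set (Triangle C)} {Q : C} (hQ : XiProjective S Q) :
    PhantomPerp S Q := fun R _ u hu => by simpa using hu Q hQ (𝟙 Q)

theorem PhantomPerp.ext {S : Set (Triangle C)} (hS : IsProperClass S) {L M N : C}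
    (h : Ses S L M N) (hL : PhantomPerp S L) (hN : PhantomPerp S N) : PhantomPerp S M := by
  obtain ⟨f, g, h, hT⟩ := h
  intro Q hQ u hu
  obtain ⟨v, hv⟩ := dist_desc₂ (hS.subset_dist hT) u (hL Q hQ _ (hu.precomp f))
  rw [hv, hN Q hQ v, comp_zero]
  intro P hP φ
  obtain ⟨(ψ : P ⟶ M), hψ : ψ ≫ g = φ⟩ := (hP _ hT).2.2 φ
  rw [← hψ, Category.assoc, ← hv, hu P hP]

theorem XiProjective.of_split {S : Set (Triangle C)} (hS : IsProperClass S) {L M N : C}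
    {f : L ⟶ M} {g : M ⟶ N}
    (hT : Triangle.mk f g (0 : N ⟶ L⟦(1 : ℤ)⟧) ∈ (distinguishedTriangles : Set (Triangle C)))
    (hL : XiProjective S L) (hN : XiProjective S N) : XiProjective S M := by
  obtain ⟨e⟩ : Nonempty (M ≅ L ⊞ N) :=
    ⟨(exists_iso_binaryBiproduct_of_distTriang _ hT rfl).choose⟩
  intro T hT
  refine ⟨fun φ ψ h => ?_, fun φ hφ => Triangle.coyoneda_exact₂ _ (hS.subset_dist hT) _ hφ,
    fun φ => ?_⟩
  · replace h : φ ≫ T.mor₁ = ψ ≫ T.mor₁ := h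
    rw [← cancel_epi e.inv]
    apply biprod.hom_ext'
    · exact (hL _ hT).1 (by simp [h])
    · exact (hN _ hT).1 (by simp [h])
  · obtain ⟨ψ₁, h₁ : ψ₁ ≫ T.mor₂ = _⟩ := (hL _ hT).2.2 (biprod.inl ≫ e.inv ≫ φ)
    obtain ⟨ψ₂, h₂ : ψ₂ ≫ T.mor₂ = _⟩ := (hN _ hT).2.2 (biprod.inr ≫ e.inv ≫ φ)
    refine ⟨e.hom ≫ biprod.desc ψ₁ ψ₂, ?_⟩
    change (e.hom ≫ biprod.desc ψ₁ ψ₂) ≫ T.mor₂ = φ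
    rw [← cancel_epi e.inv]
    apply biprod.hom_ext'
    · simp [h₁]
    · simp [h₂]

theorem split_swap {L M N : C} {f : L ⟶ M} {g : M ⟶ N}
    (hT : Triangle.mk f g (0 : N ⟶ L⟦(1 : ℤ)⟧) ∈ (distinguishedTriangles : Set (Triangle C))) :
    ∃ (j : N ⟶ M) (r : M ⟶ L), Triangle.mk j r (0 : L ⟶ N⟦(1 : ℤ)⟧) ∈
      (distinguishedTriangles : Set (Triangle C)) := by
  obtain ⟨e⟩ : Nonempty (M ≅ L ⊞ N) :=
    ⟨(exists_iso_binaryBiproduct_of_distTriang _ hT rfl).choose⟩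
  refine ⟨biprod.inr ≫ e.inv, e.hom ≫ biprod.fst,
    isomorphic_distinguished _ (binaryBiproductTriangle_distinguished N L) _
      (Triangle.isoMk _ _ (Iso.refl _) (e ≪≫ biprod.braiding _ _) (Iso.refl _) ?_ ?_ ?_)⟩
  · change (biprod.inr ≫ e.inv) ≫ (e ≪≫ biprod.braiding L N).hom = 𝟙 N ≫ biprod.inl
    apply biprod.hom_ext <;> simp
  · change (e.hom ≫ biprod.fst) ≫ 𝟙 L = (e ≪≫ biprod.braiding L N).hom ≫ biprod.snd
    simp
  · change 0 ≫ (𝟙 N)⟦(1 : ℤ)⟧' = 𝟙 L ≫ 0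
    simp

theorem dist_of_shift {X B Z : C} {x : X ⟶ B} {y : B ⟶ Z⟦(1 : ℤ)⟧} {m : Z⟦(1 : ℤ)⟧ ⟶ X⟦(1 : ℤ)⟧}
    (hT : Triangle.mk x y m ∈ (distinguishedTriangles : Set (Triangle C))) :
    ∃ z : Z ⟶ X, Triangle.mk z x y ∈ (distinguishedTriangles : Set (Triangle C)) := by
  obtain ⟨z, hz⟩ := (shiftFunctor C (1 : ℤ)).map_surjective (-m)
  refine ⟨z, ?_⟩
  rw [dist_rotate_iff, hz, neg_neg]
  exact hT

section

open ZeroObject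

theorem gClass_of_mem {S : Set (Triangle C)} (hS : IsProperClass S)
    (hE : HasEnoughXiProjectives S) {X Y : C → Prop} (h0 : X 0) {A : C} (hA : X A) :
    GClass S X Y A := by
  have hph : ∀ B D : C, Phantom S (0 : B ⟶ D) := fun _ _ _ _ _ => comp_zero
  refine gClass_of_stable (D := X) (fun B hB => ⟨0, h0, B, 0, 𝟙 B, 0, hB, ?_, fun Q _ => ?_⟩)
    (fun B hB => ⟨0, h0, B, 𝟙 B, 0, 0, hB, ?_, fun Q _ => ?_⟩) hA
  · exact mem_of_phantom hS hE (contractible_distinguished₁ B) (hph _ _)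
  · exact contraExact_of_isIso_mor₂ (contractible_distinguished₁ B)
      (inferInstanceAs (IsIso (𝟙 B))) Q
  · exact mem_of_phantom hS hE (contractible_distinguished B) (hph _ _)
  · exact contraExact_of_isIso_mor₁ (contractible_distinguished B)
      (inferInstanceAs (IsIso (𝟙 B))) Q

theorem xiProjective_zero {S : Set (Triangle C)} : XiProjective S (0 : C) := fun _ _ =>
  ⟨fun _ _ _ => (isZero_zero C).eq_of_src _ _, fun _ _ => ⟨0, (isZero_zero C).eq_of_src _ _⟩,
    fun _ => ⟨0, (isZero_zero C).eq_of_src _ _⟩⟩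

theorem XiProjective.gProjective {S : Set (Triangle C)} (hS : IsProperClass S)
    (hE : HasEnoughXiProjectives S) {P : C} (hP : XiProjective S P) : GProjective S P :=
  gClass_of_mem hS hE xiProjective_zero hP

theorem GProjective.gClass {S : Set (Triangle C)} (hS : IsProperClass S)
    (hE : HasEnoughXiProjectives S) {A : C} (hA : GProjective S A) :
    GClass S (GProjective S) (GProjective S) A :=
  gClass_of_mem hS hE (xiProjective_zero.gProjective hS hE) hA

end

theorem gClass_of_steps {S : Set (Triangle C)} {X Y : C → Prop} {K : ℤ → C}
    (H : ∀ n : ℤ, Step S X Y (K (n + 1)) (K n)) (m : ℤ) : GClass S X Y (K m) := by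
  rw [gClass_iff_step]
  refine ⟨fun n => K (n + m), by simp, fun n => ?_⟩
  simpa only [add_right_comm] using H (n + m)

theorem GClass.exists_left {S : Set (Triangle C)} {X Y : C → Prop} {A : C}
    (hA : GClass S X Y A) : ∃ L, GClass S X Y L ∧ Step S X Y L A := by
  obtain ⟨K, rfl, H⟩ := (gClass_iff_step S X Y A).1 hA
  exact ⟨K (0 + 1), gClass_of_steps H _, H 0⟩

theorem GClass.exists_right {S : Set (Triangle C)} {X Y : C → Prop} {A : C}
    (hA : GClass S X Y A) : ∃ N, GClass S X Y N ∧ Step S X Y A N := by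
  obtain ⟨K, rfl, H⟩ := (gClass_iff_step S X Y A).1 hA
  exact ⟨K (-1), gClass_of_steps H _, by simpa using H (-1)⟩

theorem Step.ses {S : Set (Triangle C)} {X Y : C → Prop} {L N : C} (h : Step S X Y L N) :
    ∃ P, X P ∧ Ses S L P N := by
  obtain ⟨P, f, g, h, hP, hT, -⟩ := h
  exact ⟨P, hP, f, g, h, hT⟩

theorem GClass.phantomPerp {S : Set (Triangle C)} {X Y : C → Prop}
    (hX : ∀ B, X B → PhantomPerp S B) (hY : ∀ Q, XiProjective S Q → Y Q) {A : C}
    (hA : GClass S X Y A) : PhantomPerp S A := by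
  obtain ⟨L, -, P, f, g, h, hP, -, hc⟩ := hA.exists_left
  exact (hX P hP).of_contraExact fun Q hQ => hc Q (hY Q hQ)

/-- The closure of a class of objects under extensions along triangles in `S`. -/
inductive ExtClosure (S : Set (Triangle C)) (B : C → Prop) : C → Prop
  | base {A : C} : B A → ExtClosure S B A
  | ext {L M N : C} : Ses S L M N → ExtClosure S B L → ExtClosure S B N → ExtClosure S B M

theorem ExtClosure.phantomPerp {S : Set (Triangle C)} (hS : IsProperClass S) {B : C → Prop}
    (hB : ∀ A, B A → PhantomPerp S A) {A : C} (hA : ExtClosure S B A) : PhantomPerp S A := by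
  induction hA with
  | base h => exact hB _ h
  | ext h _ _ h₁ h₂ => exact h₁.ext hS h h₂

variable [IsTriangulated C]

theorem exists_cocone_comp {K G A G' P : C} {f : K ⟶ G} {g : G ⟶ A} {h : A ⟶ K⟦(1 : ℤ)⟧}
    {a : G' ⟶ P} {b : P ⟶ G} {w : G ⟶ G'⟦(1 : ℤ)⟧}
    (h₁ : Triangle.mk f g h ∈ (distinguishedTriangles : Set (Triangle C)))
    (h₂ : Triangle.mk a b w ∈ (distinguishedTriangles : Set (Triangle C))) :
    ∃ (X : C) (i : G' ⟶ X) (p : X ⟶ K) (x : X ⟶ P) (m : A ⟶ X⟦(1 : ℤ)⟧),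
      Triangle.mk i p (f ≫ w) ∈ (distinguishedTriangles : Set (Triangle C)) ∧
      Triangle.mk x (b ≫ g) m ∈ (distinguishedTriangles : Set (Triangle C)) := by
  obtain ⟨X, i, p, hX⟩ := distinguished_cocone_triangle₂ (f ≫ w)
  have o := Triangulated.someOctahedron rfl h₁ (dist_rotate_iff.1 (dist_rotate_iff.1 h₂))
    (dist_rotate_iff.1 (dist_rotate_iff.1 hX))
  obtain ⟨x, hx⟩ := (shiftFunctor C (1 : ℤ)).map_surjective (-o.m₃)
  refine ⟨X, i, p, x, o.m₁, hX, ?_⟩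
  rw [dist_rotate_iff, dist_rotate_iff, hx, neg_neg, Functor.map_comp, ← Preadditive.neg_comp]
  exact o.mem

theorem exists_pullback {L B H H' P : C} {f : L ⟶ B} {g : B ⟶ H} {h : H ⟶ L⟦(1 : ℤ)⟧}
    {a : H' ⟶ P} {b : P ⟶ H} {c : H ⟶ H'⟦(1 : ℤ)⟧}
    (h₁ : Triangle.mk f g h ∈ (distinguishedTriangles : Set (Triangle C)))
    (h₂ : Triangle.mk a b c ∈ (distinguishedTriangles : Set (Triangle C))) :
    ∃ (X : C) (i : L ⟶ X) (p : X ⟶ P) (z : H' ⟶ X) (x : X ⟶ B),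
      Triangle.mk i p (b ≫ h) ∈ (distinguishedTriangles : Set (Triangle C)) ∧
      Triangle.mk z x (g ≫ c) ∈ (distinguishedTriangles : Set (Triangle C)) := by
  obtain ⟨X, i, p, x, m, hX, hX'⟩ := exists_cocone_comp (dist_rotate_iff.1 h₂) h₁
  obtain ⟨z, hz⟩ := dist_of_shift hX'
  exact ⟨X, i, p, z, x, hX, hz⟩

theorem exists_pushout {L B H P L' : C} {f : L ⟶ B} {g : B ⟶ H} {h : H ⟶ L⟦(1 : ℤ)⟧}
    {a : L ⟶ P} {b : P ⟶ L'} {c : L' ⟶ L⟦(1 : ℤ)⟧}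
    (h₁ : Triangle.mk f g h ∈ (distinguishedTriangles : Set (Triangle C)))
    (h₂ : Triangle.mk a b c ∈ (distinguishedTriangles : Set (Triangle C))) :
    ∃ (X : C) (i : P ⟶ X) (p : X ⟶ H) (z : B ⟶ X) (x : X ⟶ L'),
      Triangle.mk i p (h ≫ (-a⟦(1 : ℤ)⟧')) ∈ (distinguishedTriangles : Set (Triangle C)) ∧
      Triangle.mk z x (c ≫ (-f⟦(1 : ℤ)⟧')) ∈ (distinguishedTriangles : Set (Triangle C)) := by
  obtain ⟨X, i, p, x, m, hX, hX'⟩ :=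
    exists_cocone_comp (dist_rotate_iff.1 (dist_rotate_iff.1 h₁)) (dist_rotate_iff.1 h₂)
  obtain ⟨z, hz⟩ := dist_of_shift hX'
  exact ⟨X, i, p, z, x, hX, hz⟩

section Proper

variable {S : Set (Triangle C)} (hS : IsProperClass S) (hE : HasEnoughXiProjectives S)
include hS hE

theorem Ses.comp_deflation {K G A G' P : C} (h₁ : Ses S K G A) (h₂ : Ses S G' P G) :
    ∃ X, Ses S X P A ∧ Ses S G' X K := by
  obtain ⟨f, g, h, h₁⟩ := h₁
  obtain ⟨a, b, w, h₂⟩ := h₂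
  obtain ⟨X, i, p, x, m, hX, hX'⟩ := exists_cocone_comp (hS.subset_dist h₁) (hS.subset_dist h₂)
  refine ⟨X, ⟨x, _, m, mem_of_phantom hS hE hX' fun Q hQ φ => ?_⟩,
    ⟨i, p, _, mem_of_phantom hS hE hX ((phantom_mor₃ hS h₂).precomp f)⟩⟩
  obtain ⟨ψ, rfl⟩ := dist_lift₃ (hS.subset_dist h₁) φ (phantom_mor₃ hS h₁ Q hQ φ)
  obtain ⟨χ, rfl⟩ := dist_lift₃ (hS.subset_dist h₂) ψ (phantom_mor₃ hS h₂ Q hQ ψ)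
  have := dist_zero₂₃ hX'
  rw [Category.assoc] at this
  simp only [Category.assoc, this, comp_zero]

theorem Ses.comp_inflation {A G L P H : C} (h₁ : Ses S A G L) (h₂ : Ses S G P H) :
    ∃ B, Ses S A P B ∧ Ses S L B H := by
  obtain ⟨f, g, h, h₁⟩ := h₁
  obtain ⟨a, b, c, h₂⟩ := h₂
  obtain ⟨B, v, w, hB⟩ := distinguished_cocone_triangle (f ≫ a)
  have o := Triangulated.someOctahedron rfl (hS.subset_dist h₁) (hS.subset_dist h₂) hB
  refine ⟨B, ⟨_, v, w, mem_of_phantom hS hE hB fun Q hQ φ => ?_⟩,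
    ⟨o.m₁, o.m₃, _, mem_of_phantom hS hE o.mem ((phantom_mor₃ hS h₂).comp _)⟩⟩
  obtain ⟨ψ, hψ⟩ := dist_lift₃ (hS.subset_dist h₂) (φ ≫ o.m₃) (phantom_mor₃ hS h₂ Q hQ _)
  obtain ⟨χ, hχ⟩ := dist_lift₂ o.mem (φ - ψ ≫ v) (by
    rw [Preadditive.sub_comp, Category.assoc, o.comm₃, hψ, sub_self])
  rw [← sub_add_cancel φ (ψ ≫ v), hχ, Preadditive.add_comp, Category.assoc, Category.assoc,
    o.comm₂, phantom_mor₃ hS h₁ Q hQ, dist_zero₂₃ hB, comp_zero, add_zero]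

theorem Ses.horseshoe_left {L B H L' P₁ H' P₂ : C} (hB : Ses S L B H) (hL : Ses S L' P₁ L)
    (hH : Ses S H' P₂ H) (hP₁ : XiProjective S P₁) (hP₂ : XiProjective S P₂) :
    ∃ P X, XiProjective S P ∧ Ses S X P B ∧ Ses S L' X H' := by
  obtain ⟨f, g, h, hB⟩ := hB
  obtain ⟨a₁, b₁, c₁, hL⟩ := hL
  obtain ⟨a₂, b₂, c₂, hH⟩ := hH
  obtain ⟨E, i, p, z, x, hE₁, hE₂⟩ := exists_pullback (hS.subset_dist hB) (hS.subset_dist hH)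
  rw [phantom_mor₃ hS hB _ hP₂] at hE₁
  obtain ⟨j, r, hE₁⟩ := split_swap hE₁
  obtain ⟨P, i', p', z', x', hX₁, hX₂⟩ := exists_pullback hE₁ (hS.subset_dist hL)
  rw [comp_zero] at hX₁
  obtain ⟨X, hX, hX'⟩ := Ses.comp_deflation hS hE
    ⟨z, x, _, mem_of_phantom hS hE hE₂ ((phantom_mor₃ hS hH).precomp g)⟩
    ⟨z', x', _, mem_of_phantom hS hE hX₂ ((phantom_mor₃ hS hL).precomp r)⟩
  exact ⟨P, X, .of_split hS hX₁ hP₂ hP₁, hX, hX'⟩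

theorem Ses.horseshoe_right {L B H L' P₁ H' P₂ : C} (hB : Ses S L B H) (hL : Ses S L P₁ L')
    (hH : Ses S H P₂ H') (hP₁ : XiProjective S P₁) (hP₂ : XiProjective S P₂)
    (hperp : PhantomPerp S H) :
    ∃ P X, XiProjective S P ∧ Ses S B P X ∧ Ses S L' X H' := by
  obtain ⟨f, g, h, hB⟩ := hB
  obtain ⟨a₁, b₁, c₁, hL⟩ := hL
  obtain ⟨a₂, b₂, c₂, hH⟩ := hH
  obtain ⟨E, i, p, z, x, hE₁, hE₂⟩ := exists_pushout (hS.subset_dist hB) (hS.subset_dist hL)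
  rw [hperp _ (hP₁.shift hS) _ ((phantom_mor₃ hS hB).comp _)] at hE₁
  obtain ⟨j, r, hE₁⟩ := split_swap hE₁
  obtain ⟨P, i', p', z', x', hX₁, hX₂⟩ := exists_pushout hE₁ (hS.subset_dist hH)
  rw [zero_comp] at hX₁
  obtain ⟨X, hX, hX'⟩ := Ses.comp_inflation hS hE
    ⟨z, x, _, mem_of_phantom hS hE hE₂ ((phantom_mor₃ hS hL).comp _)⟩
    ⟨z', x', _, mem_of_phantom hS hE hX₂ ((phantom_mor₃ hS hH).comp _)⟩
  exact ⟨P, X, .of_split hS hX₁ hP₂ hP₁, hX, hX'⟩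

/-- The Gorenstein category of the class of `ξ`-Gorenstein projectives is again the class of
`ξ`-Gorenstein projectives. -/
theorem GClass.gProjective {A : C} (hA : GClass S (GProjective S) (GProjective S) A) :
    GProjective S A := by
  let D : C → Prop := ExtClosure S (GClass S (GProjective S) (GProjective S))
  have hG : ∀ B, GProjective S B → PhantomPerp S B := fun B hB =>
    GClass.phantomPerp (fun _ hP => hP.phantomPerp) (fun _ hQ => hQ) hB
  have hD : ∀ B, D B → PhantomPerp S B := fun B hB => ExtClosure.phantomPerp hS
    (fun _ h => GClass.phantomPerp hG (fun _ hQ => hQ.gProjective hS hE) h) hB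
  have hGD : ∀ B, GProjective S B → D B := fun B hB => .base (hB.gClass hS hE)
  have left : ∀ B, D B → ∃ L P, D L ∧ XiProjective S P ∧ Ses S L P B := fun B hB => by
    induction hB with
    | base h =>
      obtain ⟨K, hK, h⟩ := h.exists_left
      obtain ⟨G, hG, hKG⟩ := h.ses
      obtain ⟨G', hG', h'⟩ := GClass.exists_left hG
      obtain ⟨P, hP, hGP⟩ := h'.ses
      obtain ⟨X, hX, hX'⟩ := Ses.comp_deflation hS hE hKG hGP
      exact ⟨X, P, .ext hX' (hGD _ hG') (.base hK), hP, hX⟩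
    | ext h _ _ h₁ h₂ =>
      obtain ⟨L', P₁, hL', hP₁, h₁⟩ := h₁
      obtain ⟨H', P₂, hH', hP₂, h₂⟩ := h₂
      obtain ⟨P, X, hP, hX, hX'⟩ := Ses.horseshoe_left hS hE h h₁ h₂ hP₁ hP₂
      exact ⟨X, P, .ext hX' hL' hH', hP, hX⟩
  have right : ∀ B, D B → ∃ N P, D N ∧ XiProjective S P ∧ Ses S B P N := fun B hB => by
    induction hB with
    | base h =>
      obtain ⟨L, hL, h⟩ := h.exists_right
      obtain ⟨G, hG, hGL⟩ := h.ses
      obtain ⟨H, hH, h'⟩ := GClass.exists_right hG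
      obtain ⟨P, hP, hPH⟩ := h'.ses
      obtain ⟨X, hX, hX'⟩ := Ses.comp_inflation hS hE hGL hPH
      exact ⟨X, P, .ext hX' (.base hL) (hGD _ hH), hP, hX⟩
    | ext h _ hN h₁ h₂ =>
      obtain ⟨L', P₁, hL', hP₁, h₁⟩ := h₁
      obtain ⟨H', P₂, hH', hP₂, h₂⟩ := h₂
      obtain ⟨P, X, hP, hX, hX'⟩ := Ses.horseshoe_right hS hE h h₁ h₂ hP₁ hP₂ (hD _ hN)
      exact ⟨X, P, .ext hX' hL' hH', hP, hX⟩
  refine gClass_of_stable (D := D) (fun B hB => ?_) (fun B hB => ?_) (.base hA)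
  · obtain ⟨L, P, hL, hP, f, g, h, hT⟩ := left B hB
    exact ⟨L, hL, P, f, g, h, hP, hT, fun Q hQ => (hD B hB).contraExact_mk hS hT hQ⟩
  · obtain ⟨N, P, hN, hP, f, g, h, hT⟩ := right B hB
    exact ⟨N, hN, P, f, g, h, hP, hT, fun Q hQ => (hD N hN).contraExact_mk hS hT hQ⟩

end Proper

theorem gProjective_iff_gclass_gproj_gproj (S : Set (Triangle C))
    (hS : IsProperClass S) (hE : HasEnoughXiProjectives S) (A : C) :
    GProjective S A ↔ GClass S (GProjective S) (GProjective S) A :=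
  ⟨fun h => h.gClass hS hE, fun h => h.gProjective hS hE⟩

end GorensteinTriangulated
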